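/- Conversely to the spinor Frenet equation: let ψ : ℝ → ℂ² be differentiable with |ψ₁(s)|² + |ψ₂(s)|² = 1 for all s, let κ, τ : ℝ → ℝ, and set N(s) = a(ψ(s)), B(s) = b(ψ(s)), T(s) = c(ψ(s)). If ψ′(s) = (1/2)·(−i·τ(s)·ψ(s) + κ(s)·ψ̂(s)) for all s, then the Frenet equations hold: T′(s) = κ(s)·N(s), N′(s) = −κ(s)·T(s) + τ(s)·B(s) and B′(s) = −τ(s)·N(s) for all s. -/

import Mathlib

open Complex

noncomputable section

/-- The mate (or conjugate) of a spinor `ψ = (ψ₁, ψ₂)` is `ψ̂ = (-conj ψ₂, conj ψ₁)`. -/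
def mate (ψ : ℂ × ℂ) : ℂ × ℂ := (-(starRingEnd ℂ) ψ.2, (starRingEnd ℂ) ψ.1)

/-- The real vector `a(ψ) = (Re(ψ₁² - ψ₂²), -Im(ψ₁² + ψ₂²), -2 Re(ψ₁ψ₂))`. -/
def sa (ψ : ℂ × ℂ) : EuclideanSpace ℝ (Fin 3) :=
  !₂[(ψ.1 ^ 2 - ψ.2 ^ 2).re, -(ψ.1 ^ 2 + ψ.2 ^ 2).im, -2 * (ψ.1 * ψ.2).re]

/-- The real vector `b(ψ) = (Im(ψ₁² - ψ₂²), Re(ψ₁² + ψ₂²), -2 Im(ψ₁ψ₂))`. -/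
def sb (ψ : ℂ × ℂ) : EuclideanSpace ℝ (Fin 3) :=
  !₂[(ψ.1 ^ 2 - ψ.2 ^ 2).im, (ψ.1 ^ 2 + ψ.2 ^ 2).re, -2 * (ψ.1 * ψ.2).im]

/-- The real vector `c(ψ) = (2 Re(ψ₁ conj ψ₂), -2 Im(ψ₁ conj ψ₂), |ψ₁|² - |ψ₂|²)`. -/
def sc (ψ : ℂ × ℂ) : EuclideanSpace ℝ (Fin 3) :=
  !₂[2 * (ψ.1 * (starRingEnd ℂ) ψ.2).re, -2 * (ψ.1 * (starRingEnd ℂ) ψ.2).im,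
    ‖ψ.1‖ ^ 2 - ‖ψ.2‖ ^ 2]

/-- Reinterpret a plain vector in `Fin 3 → ℝ` as an element of Euclidean 3-space. -/
def toE (v : Fin 3 → ℝ) : EuclideanSpace ℝ (Fin 3) := WithLp.toLp 2 v


theorem hasDerivAt_vec3 {f g h : ℝ → ℝ} {v : EuclideanSpace ℝ (Fin 3)} {s : ℝ}
    (hf : HasDerivAt f (v 0) s) (hg : HasDerivAt g (v 1) s) (hh : HasDerivAt h (v 2) s) :
    HasDerivAt (fun t => (!₂[f t, g t, h t] : EuclideanSpace ℝ (Fin 3))) v s := by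
  have hp : HasDerivAt (fun t => (![f t, g t, h t] : Fin 3 → ℝ)) (WithLp.ofLp v) s := by
    rw [hasDerivAt_pi]
    intro i
    fin_cases i
    · exact hf
    · exact hg
    · exact hh
  exact ((PiLp.continuousLinearEquiv 2 ℝ (fun _ : Fin 3 => ℝ)).symm.hasFDerivAt).comp_hasDerivAt
    s hp

/-- Converse to the spinor Frenet equation: if a unit differentiable spinor field
satisfies `ψ' = (1/2)(-iτψ + κψ̂)`, then the triad `N = a(ψ), B = b(ψ), T = c(ψ)`
satisfies the Frenet equations with curvature `κ` and torsion `τ`. -/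
theorem frenet_of_spinor_equation (ψ : ℝ → ℂ × ℂ) (hψ : Differentiable ℝ ψ)
    (hunit : ∀ s, ‖(ψ s).1‖ ^ 2 + ‖(ψ s).2‖ ^ 2 = 1)
    (κ τ : ℝ → ℝ)
    (hspinor : ∀ s, deriv ψ s
      = ((1 : ℂ) / 2) • ((-Complex.I * (τ s : ℂ)) • ψ s + (κ s : ℂ) • mate (ψ s))) :
    (∀ s, deriv (fun t => sc (ψ t)) s = κ s • sa (ψ s)) ∧
    (∀ s, deriv (fun t => sa (ψ t)) s = (-κ s) • sc (ψ s) + τ s • sb (ψ s)) ∧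
    (∀ s, deriv (fun t => sb (ψ t)) s = (-τ s) • sa (ψ s)) := by
  have key : ∀ s,
      HasDerivAt (fun t => (ψ t).1.re) ((τ s * (ψ s).1.im - κ s * (ψ s).2.re) / 2) s ∧
      HasDerivAt (fun t => (ψ t).1.im) ((-τ s * (ψ s).1.re + κ s * (ψ s).2.im) / 2) s ∧
      HasDerivAt (fun t => (ψ t).2.re) ((τ s * (ψ s).2.im + κ s * (ψ s).1.re) / 2) s ∧
      HasDerivAt (fun t => (ψ t).2.im) ((-τ s * (ψ s).2.re - κ s * (ψ s).1.im) / 2) s := by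
    intro s
    have h := (hψ s).hasDerivAt
    rw [hspinor s] at h
    have h1 := h.fst
    have h2 := h.snd
    have e1 := (Complex.reCLM.hasFDerivAt (x := (ψ s).1)).comp_hasDerivAt s h1
    have e2 := (Complex.imCLM.hasFDerivAt (x := (ψ s).1)).comp_hasDerivAt s h1
    have e3 := (Complex.reCLM.hasFDerivAt (x := (ψ s).2)).comp_hasDerivAt s h2
    have e4 := (Complex.imCLM.hasFDerivAt (x := (ψ s).2)).comp_hasDerivAt s h2
    refine ⟨e1.congr_deriv ?_, e2.congr_deriv ?_, e3.congr_deriv ?_, e4.congr_deriv ?_⟩ <;>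
    · simp [mate]
      ring
  refine ⟨fun s => ?_, fun s => ?_, fun s => ?_⟩ <;>
  · obtain ⟨k1, k2, k3, k4⟩ := key s
    apply HasDerivAt.deriv
    simp only [sa, sb, sc, ← Complex.normSq_eq_norm_sq]
    simp only [Complex.normSq_apply, pow_two,
      Complex.sub_re, Complex.sub_im, Complex.add_re, Complex.add_im, Complex.mul_re,
      Complex.mul_im, Complex.conj_re, Complex.conj_im]
    apply hasDerivAt_vec3
    all_goals
      refine HasDerivAt.congr_deriv (by
        repeat' first
          | exact k1
          | exact k2
          | exact k3
          | exact k4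
          | exact hasDerivAt_const _ _
          | apply HasDerivAt.fun_sub
          | apply HasDerivAt.fun_add
          | apply HasDerivAt.fun_neg
          | apply HasDerivAt.fun_mul) ?_
      simp
      ring
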